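/- arXiv:math/0207105 — 2 statements merged into one kernel-verified Lean document; each statement's English description precedes it below -/
import Mathlib

section
/- Let d̄ ⊆ H_m with |d̄| = h ≥ 1. If rank(d̄) > ⌈log₂(h+1)⌉, then there exists a subset d̄′ ⊆ H_m with |d̄′| = h and a_3(d̄′) > a_3(d̄). Consequently, any h-element subset of H_m maximizing the number a_3 of zero-sum triples has minimum rank among h-element subsets. -/
open Finset Polynomial

/-- The ambient 𝔽₂-vector space `V = (ZMod 2)^m`. -/
abbrev V (m : ℕ) := Fin m → ZMod 2

/-- `Hm m` is the set of the `2^m - 1` nonzero vectors of `V m`. -/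
def Hm (m : ℕ) : Finset (V m) := Finset.univ.filter (fun v => v ≠ 0)

/-- `Om m` is the set of odd-weight vectors of `V m`. -/
def Om (m : ℕ) : Finset (V m) := Finset.univ.filter (fun v => (∑ i, v i) = 1)

/-- `Em m` is the set of nonzero even-weight vectors of `V m`. -/
def Em (m : ℕ) : Finset (V m) := Finset.univ.filter (fun v => v ≠ 0 ∧ (∑ i, v i) = 0)

/-- The number of `i`-element subsets of `d` whose elements sum to `ψ`. -/
def sumCount (m : ℕ) (d : Finset (V m)) (i : ℕ) (ψ : V m) : ℕ :=
  ((d.powersetCard i).filter (fun S => S.sum id = ψ)).card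

/-- `wordCount m d i = a_i(d)`, the number of `i`-element subsets of `d` summing to `0`. -/
def wordCount (m : ℕ) (d : Finset (V m)) (i : ℕ) : ℕ := sumCount m d i 0

/-- The rank of a finite set of vectors: the dimension of its span over `𝔽₂`. -/
noncomputable def rankOf (m : ℕ) (f : Finset (V m)) : ℕ :=
  Module.finrank (ZMod 2) (Submodule.span (ZMod 2) (f : Set (V m)))

/-- `d₁` has smaller aberration than `d₂`. -/
def SmallerAberration (m : ℕ) (d₁ d₂ : Finset (V m)) : Prop :=
  ∃ s, 1 ≤ s ∧ wordCount m d₁ s < wordCount m d₂ s ∧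
    ∀ t < s, wordCount m d₁ t = wordCount m d₂ t

/-- `d` is a minimum aberration design. -/
def IsMA (m : ℕ) (d : Finset (V m)) : Prop :=
  d ⊆ Hm m ∧ ∀ d' ⊆ Hm m, d'.card = d.card → ¬ SmallerAberration m d' d

/-- The word-length pattern polynomial `P_f(X) = ∑ a_i(f) X^i` of a design `f`. -/
noncomputable def WLPP (m : ℕ) (f : Finset (V m)) : Polynomial ℤ :=
  ∑ i ∈ Finset.range (f.card + 1), (wordCount m f i : ℤ) • X ^ i

/-- `Q_ψ(X) = ∑ q_i(ψ) X^i`, where `q_i(ψ)` counts `i`-element subsets of `O_m` summing to `ψ`. -/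
noncomputable def Qpoly (m : ℕ) (ψ : V m) : Polynomial ℤ :=
  ∑ i ∈ Finset.range ((Om m).card + 1), (sumCount m (Om m) i ψ : ℤ) • X ^ i

/-- The nontrivial character of `𝔽₂`, with integer values. -/
def signZ (a : ZMod 2) : ℤ := if a = 0 then 1 else -1

lemma signZ_zero : signZ 0 = 1 := rfl

lemma signZ_one : signZ 1 = -1 := rfl

lemma signZ_add (a b : ZMod 2) : signZ (a + b) = signZ a * signZ b := by
  revert a b; decide

lemma zmod_two_eq_one_of_ne_zero {a : ZMod 2} (ha : a ≠ 0) : a = 1 := by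
  revert a; decide

section SchurTriples

variable {W : Type*} [AddCommGroup W] [Module (ZMod 2) W] [DecidableEq W]

omit [DecidableEq W] in
lemma add_self_eq_zero_of_zmod_two (x : W) : x + x = 0 := by
  rw [← two_smul (ZMod 2) x, show (2 : ZMod 2) = 0 from rfl, zero_smul]

omit [DecidableEq W] in
lemma add_eq_zero_iff_eq_of_zmod_two (x y : W) : x + y = 0 ↔ x = y := by
  constructor
  · intro h
    exact add_right_cancel (h.trans (add_self_eq_zero_of_zmod_two y).symm)
  · rintro rfl
    exact add_self_eq_zero_of_zmod_two x

instance decidablePredMemKer (φ : Module.Dual (ZMod 2) W) :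
    DecidablePred (· ∈ LinearMap.ker φ) :=
  fun x => decEq (φ x) 0

/-- The number of pairs in `A` whose sum lies in `A`. -/
def schurCount (A : Finset W) : ℕ := #{p ∈ A ×ˢ A | p.1 + p.2 ∈ A}

/-- The value of the Fourier transform of the indicator of `A` at the functional `φ`. -/
def bias (A : Finset W) (φ : Module.Dual (ZMod 2) W) : ℤ := ∑ x ∈ A, signZ (φ x)

omit [DecidableEq W] in
lemma bias_zero (A : Finset W) : bias A 0 = #A := by
  simp [bias, signZ_zero]

omit [DecidableEq W] in
lemma bias_eq_card_sub_card (A : Finset W) (φ : Module.Dual (ZMod 2) W) :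
    bias A φ = #{x ∈ A | φ x = 0} - #{x ∈ A | ¬ φ x = 0} := by
  simp only [bias, signZ, Finset.sum_ite, Finset.sum_const]
  simp [sub_eq_add_neg]

omit [DecidableEq W] in
lemma card_filter_add_card_filter (A : Finset W) (φ : Module.Dual (ZMod 2) W) :
    #{x ∈ A | φ x = 0} + #{x ∈ A | ¬ φ x = 0} = #A :=
  Finset.card_filter_add_card_filter_not _

omit [Module (ZMod 2) W] in
lemma schurCount_map {W' : Type*} [AddCommGroup W'] [DecidableEq W']
    (f : W' ↪ W) (hf : ∀ x y, f (x + y) = f x + f y) (A : Finset W') :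
    schurCount (A.map f) = schurCount A := by
  symm
  refine Finset.card_bij (fun p _ => (f p.1, f p.2)) ?_ ?_ ?_
  · simp only [mem_filter, mem_product, mem_map']
    rintro p ⟨⟨h1, h2⟩, h3⟩
    exact ⟨⟨h1, h2⟩, by rw [← hf]; exact (mem_map' f).2 h3⟩
  · rintro ⟨a, b⟩ _ ⟨c, d⟩ _ h
    simpa using h
  · rintro ⟨a, b⟩ h
    simp only [mem_filter, mem_product, mem_map] at h
    obtain ⟨⟨⟨x, hx, rfl⟩, ⟨y, hy, rfl⟩⟩, ⟨z, hz, hxy⟩⟩ := h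
    rw [← hf, f.injective.eq_iff] at hxy
    subst hxy
    exact ⟨(x, y), by simp [hx, hy, hz], rfl⟩

/-- Splitting the triples according to a hyperplane. -/
lemma schurCount_le_add (A : Finset W) (φ : Module.Dual (ZMod 2) W) :
    schurCount A ≤ schurCount {x ∈ A | φ x = 0} + 3 * #{x ∈ A | ¬ φ x = 0} ^ 2 := by
  set B := ({x ∈ A | φ x = 0} : Finset W) with hB
  set C := ({x ∈ A | ¬ φ x = 0} : Finset W) with hC
  set S := ({p ∈ A ×ˢ A | p.1 + p.2 ∈ A} : Finset (W × W)) with hS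
  have hsum : ∀ a b : ZMod 2, a ≠ 0 → b = 0 → a + b ≠ 0 := by decide
  have h1 : #{p ∈ S | φ p.1 = 0 ∧ φ p.2 = 0} ≤ schurCount B := by
    apply card_le_card
    intro p
    simp only [hS, hB, mem_filter, mem_product, map_add]
    rintro ⟨⟨⟨h1, h2⟩, h3⟩, h4, h5⟩
    simp [*]
  have h2 : #{p ∈ S | ¬ φ p.1 = 0 ∧ ¬ φ p.2 = 0} ≤ #(C ×ˢ C) := by
    apply card_le_card
    intro p
    simp only [hS, hC, mem_filter, mem_product]
    tauto
  have h3 : #{p ∈ S | ¬ φ p.1 = 0 ∧ φ p.2 = 0} ≤ #(C ×ˢ C) := by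
    refine card_le_card_of_injOn (fun p => (p.1, p.1 + p.2)) ?_ ?_
    · intro p
      simp only [hS, hC, coe_filter, coe_product, mem_product, mem_filter, Set.mem_ofPred_eq,
        Set.mem_prod, map_add]
      rintro ⟨⟨⟨h1, h2⟩, h3⟩, h4, h5⟩
      exact ⟨⟨h1, h4⟩, h3, hsum _ _ h4 h5⟩
    · rintro ⟨a, b⟩ _ ⟨c, d⟩ _ h
      simp only [Prod.mk.injEq] at h
      obtain ⟨rfl, h⟩ := h
      simpa using h
  have h4 : #{p ∈ S | φ p.1 = 0 ∧ ¬ φ p.2 = 0} ≤ #(C ×ˢ C) := by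
    refine card_le_card_of_injOn (fun p => (p.2, p.2 + p.1)) ?_ ?_
    · intro p
      simp only [hS, hC, coe_filter, coe_product, mem_product, mem_filter, Set.mem_ofPred_eq,
        Set.mem_prod, map_add]
      rintro ⟨⟨⟨h1, h2⟩, h3⟩, h4, h5⟩
      exact ⟨⟨h2, h5⟩, add_comm p.1 p.2 ▸ h3, hsum _ _ h5 h4⟩
    · rintro ⟨a, b⟩ _ ⟨c, d⟩ _ h
      simp only [Prod.mk.injEq] at h
      obtain ⟨rfl, h⟩ := h
      simpa using h
  have hsplit : #S = #{p ∈ S | φ p.1 = 0 ∧ φ p.2 = 0} + #{p ∈ S | φ p.1 = 0 ∧ ¬ φ p.2 = 0} +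
      (#{p ∈ S | ¬ φ p.1 = 0 ∧ φ p.2 = 0} + #{p ∈ S | ¬ φ p.1 = 0 ∧ ¬ φ p.2 = 0}) := by
    simp only [← filter_filter]
    rw [Finset.card_filter_add_card_filter_not, Finset.card_filter_add_card_filter_not,
      Finset.card_filter_add_card_filter_not]
  rw [card_product] at h2 h3 h4
  change #S ≤ _
  nlinarith

variable [Fintype W] [Fintype (Module.Dual (ZMod 2) W)]

omit [DecidableEq W] in
lemma card_dual_eq_card :
    Fintype.card (Module.Dual (ZMod 2) W) = Fintype.card W := by
  rw [Module.card_eq_pow_finrank (K := ZMod 2), Module.card_eq_pow_finrank (K := ZMod 2) (V := W),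
    Subspace.dual_finrank_eq]

lemma sum_dual_signZ (x : W) :
    ∑ φ : Module.Dual (ZMod 2) W, signZ (φ x) = if x = 0 then (Fintype.card W : ℤ) else 0 := by
  split_ifs with hx
  · simp [hx, signZ_zero, card_dual_eq_card]
  · obtain ⟨ψ, hψ⟩ := not_forall.1 (mt (Module.forall_dual_apply_eq_zero_iff (ZMod 2) x).1 hx)
    have h := Equiv.sum_comp (Equiv.addRight ψ) (fun φ : Module.Dual (ZMod 2) W => signZ (φ x))
    simp only [Equiv.coe_addRight, LinearMap.add_apply, signZ_add,
      zmod_two_eq_one_of_ne_zero hψ, signZ_one, ← Finset.sum_mul] at h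
    linarith

omit [Fintype (Module.Dual (ZMod 2) W)] [DecidableEq W] in
lemma sum_signZ_eq_zero {φ : Module.Dual (ZMod 2) W} (hφ : φ ≠ 0) :
    ∑ x : W, signZ (φ x) = 0 := by
  obtain ⟨y, hy⟩ := not_forall.1 (mt LinearMap.ext hφ : ¬ ∀ x, φ x = (0 : Module.Dual _ W) x)
  have h := Equiv.sum_comp (Equiv.addRight y) (fun x : W => signZ (φ x))
  simp only [Equiv.coe_addRight, map_add, signZ_add,
    zmod_two_eq_one_of_ne_zero hy, signZ_one, ← Finset.sum_mul] at h
  linarith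

lemma sum_bias {A : Finset W} (h0 : 0 ∈ A) :
    ∑ φ : Module.Dual (ZMod 2) W, bias A φ = Fintype.card W := by
  simp only [bias]
  rw [Finset.sum_comm]
  simp [sum_dual_signZ, h0]

lemma sum_bias_sq (A : Finset W) :
    ∑ φ : Module.Dual (ZMod 2) W, bias A φ ^ 2 = Fintype.card W * #A := by
  simp only [bias, sq, Finset.sum_mul_sum, ← signZ_add, ← map_add]
  rw [Finset.sum_comm]
  simp_rw [Finset.sum_comm (s := (univ : Finset (Module.Dual (ZMod 2) W))), sum_dual_signZ,
    add_eq_zero_iff_eq_of_zmod_two]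
  simp [mul_comm]

lemma sum_bias_cube (A : Finset W) :
    ∑ φ : Module.Dual (ZMod 2) W, bias A φ ^ 3 = Fintype.card W * schurCount A := by
  have hcube : ∀ φ : Module.Dual (ZMod 2) W,
      bias A φ ^ 3 = ∑ x ∈ A, ∑ y ∈ A, ∑ z ∈ A, signZ (φ (x + y + z)) := by
    intro φ
    simp_rw [map_add, signZ_add, ← Finset.mul_sum, ← Finset.sum_mul, ← Finset.mul_sum,
      ← Finset.sum_mul]
    rw [← bias]
    ring
  simp_rw [hcube]
  rw [Finset.sum_comm]
  simp_rw [Finset.sum_comm (s := (univ : Finset (Module.Dual (ZMod 2) W))), sum_dual_signZ,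
    add_eq_zero_iff_eq_of_zmod_two]
  simp only [schurCount, Finset.card_filter, Finset.sum_product, Finset.sum_ite_eq]
  push_cast
  simp [Finset.mul_sum, Finset.sum_ite, mul_comm]

/-- The triple counts of a set and its complement determine each other. -/
lemma card_mul_schurCount_add_compl (A : Finset W) :
    (Fintype.card W : ℤ) * (schurCount A + schurCount Aᶜ) = (#A : ℤ) ^ 3 + (#Aᶜ : ℤ) ^ 3 := by
  rw [mul_add, ← sum_bias_cube, ← sum_bias_cube, ← Finset.sum_add_distrib,
    Finset.sum_eq_single 0]
  · simp [bias_zero]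
  · intro φ _ hφ
    have h : bias A φ + bias Aᶜ φ = 0 := by
      rw [bias, bias, Finset.sum_add_sum_compl, sum_signZ_eq_zero hφ]
    rw [eq_neg_of_add_eq_zero_left h]
    ring
  · simp

/-- In a space of size `2q`, the triple count of `A` and that of its complement are related by
a formula in `q` and `#A`. -/
lemma schurCount_add_schurCount_compl (A : Finset W) {q : ℤ}
    (hq : (Fintype.card W : ℤ) = 2 * q) :
    (schurCount A : ℤ) + schurCount Aᶜ = q ^ 2 + 3 * (#A - q) ^ 2 := by
  have h := card_mul_schurCount_add_compl A
  have hc : (#A : ℤ) + #Aᶜ = 2 * q := by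
    rw [← hq]; exact_mod_cast Finset.card_add_card_compl A
  have hq0 : 0 < q := by
    have : (0 : ℤ) < Fintype.card W := by exact_mod_cast Fintype.card_pos
    linarith
  have hc' : (#Aᶜ : ℤ) = 2 * q - #A := by linarith
  rw [hq, hc'] at h
  have h2 : 2 * q * ((schurCount A : ℤ) + schurCount Aᶜ) =
      2 * q * (q ^ 2 + 3 * (#A - q) ^ 2) := by
    rw [h]; ring
  exact mul_left_cancel₀ (by positivity) h2

/-- If `A` has at most half the size of the space and `φ` is a nonzero functional of maximal bias,
then the triple count is at most `#A` times the size of the larger part. -/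
lemma schurCount_le_card_mul {A : Finset W} {φ : Module.Dual (ZMod 2) W}
    (hmax : ∀ ψ, ψ ≠ 0 → bias A ψ ≤ bias A φ) (hhalf : 2 * #A ≤ Fintype.card W) :
    schurCount A ≤ #A * #{x ∈ A | φ x = 0} := by
  have hb := bias_eq_card_sub_card A φ
  have hc : (#{x ∈ A | φ x = 0} : ℤ) + #{x ∈ A | ¬ φ x = 0} = #A := by
    exact_mod_cast card_filter_add_card_filter A φ
  have hle : ∑ ψ : Module.Dual (ZMod 2) W, bias A ψ ^ 3 ≤
      ∑ ψ : Module.Dual (ZMod 2) W, (bias A φ * bias A ψ ^ 2 +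
        if ψ = 0 then (#A : ℤ) ^ 3 - bias A φ * #A ^ 2 else 0) := by
    refine Finset.sum_le_sum fun ψ _ => ?_
    split_ifs with hψ
    · subst hψ
      rw [bias_zero]
      linarith
    · nlinarith [hmax ψ hψ, sq_nonneg (bias A ψ)]
  rw [Finset.sum_add_distrib, ← Finset.mul_sum, sum_bias_sq, sum_bias_cube,
    Finset.sum_ite_eq' univ, if_pos (mem_univ _)] at hle
  have hN : (2 : ℤ) * #A ≤ Fintype.card W := by exact_mod_cast hhalf
  have hpos : (0 : ℤ) < Fintype.card W := by exact_mod_cast Fintype.card_pos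
  zify
  set n : ℤ := (#A : ℤ)
  set a : ℤ := (#{x ∈ A | φ x = 0} : ℤ)
  set b : ℤ := (#{x ∈ A | ¬ φ x = 0} : ℤ)
  have hb0 : 0 ≤ b := by positivity
  have hn0 : 0 ≤ n := by positivity
  refine le_of_mul_le_mul_left ?_ hpos
  rw [hb] at hle
  have h3 : 2 * n * (n * b) ≤ Fintype.card W * (n * b) :=
    mul_le_mul_of_nonneg_right hN (by positivity)
  have ha : a = n - b := by linarith
  rw [ha] at hle ⊢
  nlinarith

end SchurTriples

section Induction

variable {W : Type*} [AddCommGroup W] [Module (ZMod 2) W] [DecidableEq W] [Fintype W]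

/-- A spanning set containing `0` of at most half the size of the space has a nonzero functional of
maximal bias; its zero part is the larger one and spans the kernel. -/
lemma exists_functional_of_span_eq_top {A : Finset W} (h0 : 0 ∈ A)
    (hspan : Submodule.span (ZMod 2) (A : Set W) = ⊤) (hhalf : 2 * #A ≤ Fintype.card W) :
    ∃ φ : Module.Dual (ZMod 2) W, φ ≠ 0 ∧
      #{x ∈ A | ¬ φ x = 0} < #{x ∈ A | φ x = 0} ∧
      0 < #{x ∈ A | ¬ φ x = 0} ∧
      schurCount A ≤ #A * #{x ∈ A | φ x = 0} ∧
      Submodule.span (ZMod 2) (Finset.subtype (· ∈ LinearMap.ker φ) A : Set (LinearMap.ker φ)) =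
        ⊤ := by
  have : Finite (Module.Dual (ZMod 2) W) := Module.finite_of_finite (ZMod 2)
  let := Fintype.ofFinite (Module.Dual (ZMod 2) W)
  have hApos : 0 < #A := Finset.card_pos.2 ⟨0, h0⟩
  have hsum : ∑ φ ∈ univ.erase (0 : Module.Dual (ZMod 2) W), bias A φ = Fintype.card W - #A := by
    have h := Finset.add_sum_erase univ (bias A) (mem_univ (0 : Module.Dual (ZMod 2) W))
    rw [sum_bias h0, bias_zero] at h
    linarith
  have hpos : 0 < ∑ φ ∈ univ.erase (0 : Module.Dual (ZMod 2) W), bias A φ := by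
    rw [hsum]
    have : #A < Fintype.card W := by omega
    have : (#A : ℤ) < Fintype.card W := by exact_mod_cast this
    linarith
  obtain ⟨φ₀, hφ₀, hbias₀⟩ := Finset.exists_lt_of_sum_lt
    (s := univ.erase (0 : Module.Dual (ZMod 2) W)) (f := fun _ => (0 : ℤ)) (g := bias A)
    (by rwa [Finset.sum_const_zero])
  obtain ⟨φ, hφ, hmax⟩ := Finset.exists_max_image _ (bias A) ⟨φ₀, hφ₀⟩
  have hφ0 : φ ≠ 0 := (mem_erase.1 hφ).1
  replace hmax : ∀ ψ, ψ ≠ 0 → bias A ψ ≤ bias A φ := fun ψ hψ =>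
    hmax ψ (mem_erase.2 ⟨hψ, mem_univ _⟩)
  have hb := bias_eq_card_sub_card A φ
  have hC : 0 < #{x ∈ A | ¬ φ x = 0} := by
    rw [Finset.card_pos]
    by_contra hne
    rw [Finset.not_nonempty_iff_eq_empty, Finset.filter_eq_empty_iff] at hne
    apply hφ0
    have hle : Submodule.span (ZMod 2) (A : Set W) ≤ LinearMap.ker φ :=
      Submodule.span_le.2 fun x hx => not_not.1 (hne hx)
    rw [hspan, top_le_iff, LinearMap.ker_eq_top] at hle
    exact hle
  refine ⟨φ, hφ0, ?_, hC, schurCount_le_card_mul hmax hhalf, ?_⟩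
  · have := hmax φ₀ (mem_erase.1 hφ₀).1
    zify
    linarith
  · by_contra hne
    obtain ⟨χ, hχ0, hχ⟩ := Submodule.exists_le_ker_of_lt_top _ (lt_top_iff_ne_top.2 hne)
    obtain ⟨ψ, hψ⟩ := LinearMap.exists_extend χ
    have hψker : ∀ x (hx : x ∈ LinearMap.ker φ), ψ x = χ ⟨x, hx⟩ := fun x hx => by
      rw [← hψ]; rfl
    have hψB : ∀ x ∈ A, φ x = 0 → ψ x = 0 := fun x hx hx0 => by
      rw [hψker x hx0]
      exact hχ (Submodule.subset_span (by simpa using hx))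
    obtain ⟨⟨y, hy⟩, hχy⟩ : ∃ y, χ y ≠ 0 := not_forall.1 fun h => hχ0 (LinearMap.ext h)
    have hψ1 : ψ ≠ 0 := by
      rintro rfl
      exact hχy (hψker y hy).symm
    have hψ2 : ψ + φ ≠ 0 := by
      intro h
      have h' := LinearMap.congr_fun h y
      rw [LinearMap.add_apply, hψker y hy, show φ y = 0 from hy, add_zero] at h'
      exact hχy h'
    have hadd : bias A ψ + bias A (ψ + φ) = 2 * #{x ∈ A | φ x = 0} := by
      rw [bias, bias, ← Finset.sum_add_distrib,
        Finset.sum_congr (g := fun x => if φ x = 0 then (2 : ℤ) else 0) rfl]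
      · rw [← Finset.sum_filter, Finset.sum_const, nsmul_eq_mul, mul_comm]
      · intro x hx
        rw [LinearMap.add_apply, signZ_add]
        split_ifs with hx0
        · rw [hψB x hx hx0, hx0, signZ_zero]
          norm_num
        · rw [zmod_two_eq_one_of_ne_zero hx0, signZ_one]
          ring
    have := hmax _ hψ1
    have := hmax _ hψ2
    have : (0 : ℤ) < #{x ∈ A | ¬ φ x = 0} := by exact_mod_cast hC
    linarith

omit [Fintype W] in
lemma schurCount_subtype (A : Finset W) (φ : Module.Dual (ZMod 2) W) :
    schurCount (Finset.subtype (· ∈ LinearMap.ker φ) A) = schurCount {x ∈ A | φ x = 0} := by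
  rw [← schurCount_map (Function.Embedding.subtype (· ∈ LinearMap.ker φ)) (fun _ _ => rfl),
    Finset.subtype_map]
  rfl

lemma schurCount_le_of_card_eq {A : Finset W} {q : ℤ} (hq : (Fintype.card W : ℤ) = 2 * q) :
    (schurCount A : ℤ) ≤ q ^ 2 + 3 * (#A - q) ^ 2 := by
  have : Finite (Module.Dual (ZMod 2) W) := Module.finite_of_finite (ZMod 2)
  let := Fintype.ofFinite (Module.Dual (ZMod 2) W)
  have := schurCount_add_schurCount_compl A hq
  have : (0 : ℤ) ≤ schurCount Aᶜ := by positivity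
  linarith

end Induction

lemma lt_of_split_bounds {T S a b p : ℤ} (hp : 0 < p) (hsplit : T ≤ S + 3 * b ^ 2)
    (hS : S < p ^ 2 + 3 * (a - p) ^ 2) (ha : a ≤ 2 * p) (hab : 2 * p < a + b)
    (hT : T ≤ (a + b) * a) : T < (2 * p) ^ 2 + 3 * (a + b - 2 * p) ^ 2 := by
  rcases le_or_gt b p with hb | hb
  · have := mul_nonneg (sub_nonneg.2 ha) (sub_nonneg.2 hb)
    linarith
  · obtain ⟨k, hk⟩ : ∃ k, k = a + b - 2 * p := ⟨_, rfl⟩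
    have hk0 : 0 < k := by linarith
    have h1 : (a + b) * a < (2 * p + k) * (p + k) := by
      rw [show a + b = 2 * p + k by linarith]
      exact mul_lt_mul_of_pos_left (by linarith) (by linarith)
    rw [← hk]
    nlinarith [sq_nonneg (p - k), mul_pos hp hk0]

/-- A spanning set containing `0` whose size is at most half that of the space has fewer triples
than an initial segment of the same size. -/
theorem schurCount_lt_of_span_eq_top (r : ℕ) :
    ∀ {W : Type*} [AddCommGroup W] [Module (ZMod 2) W] [DecidableEq W] [Fintype W]
      {A : Finset W} {s : ℕ}, Fintype.card W = 2 ^ r → 0 ∈ A →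
      Submodule.span (ZMod 2) (A : Set W) = ⊤ → 2 * #A ≤ 2 ^ r →
      2 ^ s < #A → #A ≤ 2 ^ (s + 1) →
      (schurCount A : ℤ) < (2 ^ s) ^ 2 + 3 * (#A - 2 ^ s) ^ 2 := by
  induction r with
  | zero =>
    intro W _ _ _ _ A s _ h0 _ hhalf _ _
    have : 0 < #A := Finset.card_pos.2 ⟨0, h0⟩
    omega
  | succ r ih =>
    intro W _ _ _ _ A s hW h0 hspan hhalf hs1 hs2
    obtain ⟨φ, hφ, hlt, hpos, hn, hspan'⟩ :=
      exists_functional_of_span_eq_top h0 hspan (by rw [hW]; exact hhalf)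
    have hK : Fintype.card (LinearMap.ker φ) = 2 ^ r := by
      have h := Module.Dual.finrank_ker_add_one_of_ne_zero hφ
      rw [Module.card_eq_pow_finrank (K := ZMod 2), ZMod.card] at hW ⊢
      have := Nat.pow_right_injective le_rfl hW
      congr 1
      omega
    have hsplit := schurCount_le_add A φ
    have hcard := card_filter_add_card_filter A φ
    have hB0 : (0 : LinearMap.ker φ) ∈ Finset.subtype (· ∈ LinearMap.ker φ) A := by
      simpa using h0
    have ihB := fun s' => ih (s := s') hK hB0 hspan'
    have hBK : #(Finset.subtype (· ∈ LinearMap.ker φ) A) = #{x ∈ A | φ x = 0} :=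
      Finset.card_subtype _ _
    rw [schurCount_subtype, hBK] at ihB
    have hsr : s < r := by
      rw [pow_succ] at hhalf
      exact (Nat.pow_lt_pow_iff_right (a := 2) (by norm_num)).1 (by omega)
    have hBn := schurCount_le_of_card_eq (A := Finset.subtype (· ∈ LinearMap.ker φ) A) (q := 2 ^ s)
    rw [schurCount_subtype, hBK, hK] at hBn
    generalize schurCount A = T at *
    generalize schurCount {x ∈ A | φ x = 0} = TB at *
    generalize #{x ∈ A | φ x = 0} = a at *
    generalize #{x ∈ A | ¬ φ x = 0} = b at *
    generalize #A = n at *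
    subst hcard
    have hsplit' : (T : ℤ) ≤ TB + 3 * (b : ℤ) ^ 2 := by exact_mod_cast hsplit
    have hpow : 2 ^ (s + 1) ≤ 2 ^ r := Nat.pow_le_pow_right (by norm_num) hsr
    rw [pow_succ] at hpow
    have hposZ : (0 : ℤ) < b := by exact_mod_cast hpos
    rcases lt_or_ge (2 ^ s) a with ha | ha
    · have haZ : (2 ^ s : ℤ) < a := by exact_mod_cast ha
      have hTB : (TB : ℤ) ≤ (2 ^ s) ^ 2 + 3 * (a - 2 ^ s) ^ 2 := by
        rcases le_or_gt (2 * a) (2 ^ r) with har | har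
        · exact (ihB s har ha (by omega)).le
        · have hr : r < s + 2 := by
            refine (Nat.pow_lt_pow_iff_right (a := 2) (by norm_num)).1 ?_
            rw [pow_succ] at hs2 ⊢
            rw [pow_succ]
            omega
          apply hBn
          rw [show r = s + 1 by omega]
          push_cast
          ring
      push_cast
      nlinarith [mul_pos (sub_pos.2 haZ) hposZ]
    · obtain ⟨s, rfl⟩ : ∃ s', s = s' + 1 := Nat.exists_eq_succ_of_ne_zero fun hs => by
        subst hs
        omega
      have hTB := ihB s (by omega) (by rw [pow_succ] at *; omega) ha
      have haZ : (a : ℤ) ≤ 2 ^ (s + 1) := by exact_mod_cast ha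
      have hnZ : (T : ℤ) ≤ (a + b) * a := by exact_mod_cast hn
      have hs1Z : (2 ^ (s + 1) : ℤ) < a + b := by exact_mod_cast hs1
      have hp : (0 : ℤ) < 2 ^ s := by positivity
      push_cast
      rw [pow_succ' (2 : ℤ) s] at haZ hs1Z ⊢
      exact lt_of_split_bounds hp hsplit' hTB haZ hs1Z hnZ

/-- Between a hyperplane and the whole space, every size is attained by a set with the maximal
number of triples. -/
lemma exists_schurCount_eq {W : Type*} [AddCommGroup W] [Module (ZMod 2) W] [DecidableEq W]
    [Fintype W] {s n : ℕ} (hW : Fintype.card W = 2 ^ (s + 1)) (hn1 : 2 ^ s ≤ n)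
    (hn2 : n ≤ 2 ^ (s + 1)) :
    ∃ A : Finset W, 0 ∈ A ∧ #A = n ∧
      (schurCount A : ℤ) = (2 ^ s) ^ 2 + 3 * (n - 2 ^ s) ^ 2 := by
  have : Finite (Module.Dual (ZMod 2) W) := Module.finite_of_finite (ZMod 2)
  let := Fintype.ofFinite (Module.Dual (ZMod 2) W)
  have hfr : Module.finrank (ZMod 2) W = s + 1 := by
    rw [Module.card_eq_pow_finrank (K := ZMod 2), ZMod.card] at hW
    exact Nat.pow_right_injective le_rfl hW
  obtain ⟨φ, hφ⟩ : ∃ φ : Module.Dual (ZMod 2) W, φ ≠ 0 := by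
    have : Nontrivial W := Module.nontrivial_of_finrank_pos (R := ZMod 2) (by omega)
    obtain ⟨x, hx⟩ := exists_ne (0 : W)
    obtain ⟨φ, hφ⟩ := not_forall.1 (mt (Module.forall_dual_apply_eq_zero_iff (ZMod 2) x).1 hx)
    exact ⟨φ, fun h => hφ (by rw [h]; rfl)⟩
  have hK : #{x : W | φ x = 0} = 2 ^ s := by
    have h := Module.Dual.finrank_ker_add_one_of_ne_zero hφ
    rw [← Fintype.card_subtype]
    change Fintype.card (LinearMap.ker φ) = 2 ^ s
    rw [Module.card_eq_pow_finrank (K := ZMod 2), ZMod.card]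
    congr 1
    omega
  obtain ⟨A, hKA, -, hA⟩ := Finset.exists_subsuperset_card_eq (subset_univ {x : W | φ x = 0})
    (hK.trans_le hn1) (by rw [card_univ, hW]; exact hn2)
  have hcompl : schurCount Aᶜ = 0 := by
    rw [schurCount, card_eq_zero, filter_eq_empty_iff]
    rintro ⟨x, y⟩ hxy h
    have key : ∀ z ∈ Aᶜ, φ z = 1 := fun z hz => zmod_two_eq_one_of_ne_zero fun h =>
      (mem_compl.1 hz) (hKA (by simpa using h))
    rw [mem_product] at hxy
    have h1 := key _ h
    rw [map_add, key _ hxy.1, key _ hxy.2] at h1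
    exact absurd h1 (by decide)
  have h := schurCount_add_schurCount_compl A (q := 2 ^ s) (by rw [hW]; push_cast; ring)
  rw [hcompl, hA] at h
  exact ⟨A, hKA (by simp), hA, by simpa using h⟩

lemma exists_submodule_finrank_eq {K W : Type*} [Field K] [AddCommGroup W] [Module K W]
    [Module.Finite K W] {n : ℕ} (hn : n ≤ Module.finrank K W) :
    ∃ U : Submodule K W, Module.finrank K U = n := by
  let b := Module.finBasis K W
  refine ⟨Submodule.span K (Set.range (b ∘ Fin.castLE hn)), ?_⟩
  rw [finrank_span_eq_card (b.linearIndependent.comp _ (Fin.castLE_injective hn)),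
    Fintype.card_fin]

section WordCount

variable {m : ℕ}

lemma zero_notMem_of_subset_Hm {d : Finset (V m)} (hd : d ⊆ Hm m) : 0 ∉ d := fun h => by
  simpa [Hm] using hd h

lemma add_mem_of_card_eq_three {S : Finset (V m)} (hS3 : #S = 3) (hS0 : S.sum id = 0)
    {x y : V m} (hx : x ∈ S) (hy : y ∈ S) (hxy : x ≠ y) : x + y ∈ S := by
  have hz : ((S.erase x).erase y).card = 1 := by
    rw [card_erase_of_mem (mem_erase.2 ⟨hxy.symm, hy⟩), card_erase_of_mem hx, hS3]
  obtain ⟨z, hz⟩ := card_eq_one.1 hz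
  rw [← add_sum_erase S id hx, ← add_sum_erase _ id (mem_erase.2 ⟨hxy.symm, hy⟩), hz,
    sum_singleton, id, id, id, ← add_assoc, add_eq_zero_iff_eq_of_zmod_two] at hS0
  rw [hS0]
  exact mem_of_mem_erase (mem_of_mem_erase (hz ▸ mem_singleton_self z))

lemma card_pairs_eq_six_mul_wordCount {d : Finset (V m)} (h0 : 0 ∉ d) :
    #{p ∈ d ×ˢ d | p.1 + p.2 ∈ d} = 6 * wordCount m d 3 := by
  have hchar : ∀ x : V m, x + x = 0 := add_self_eq_zero_of_zmod_two
  have hne : ∀ {x y : V m}, x ∈ d → y ∈ d → x + y ∈ d → x ≠ y ∧ x ≠ x + y ∧ y ≠ x + y := by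
    intro x y hx hy hxy
    refine ⟨?_, ?_, ?_⟩
    · rintro rfl
      exact h0 (hchar x ▸ hxy)
    · intro h
      exact h0 (left_eq_add.1 h ▸ hy)
    · intro h
      exact h0 (right_eq_add.1 h ▸ hx)
  rw [Finset.card_eq_sum_card_fiberwise
    (f := fun p : V m × V m => ({p.1, p.2, p.1 + p.2} : Finset (V m)))
    (t := (d.powersetCard 3).filter (fun S => S.sum id = 0)),
    Finset.sum_congr (g := fun _ => 6) rfl]
  · rw [Finset.sum_const, smul_eq_mul, mul_comm]
    rfl
  · intro S hS
    rw [mem_filter, mem_powersetCard] at hS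
    obtain ⟨⟨hSd, hS3⟩, hS0⟩ := hS
    have hoff : #S.offDiag = 6 := by rw [offDiag_card, hS3]
    rw [← hoff]
    congr 1
    ext ⟨x, y⟩
    simp only [mem_filter, mem_product, mem_offDiag]
    constructor
    · rintro ⟨⟨⟨hx, hy⟩, hxy⟩, hS⟩
      refine ⟨?_, ?_, (hne hx hy hxy).1⟩ <;> rw [← hS] <;> simp
    · rintro ⟨hx, hy, hxy⟩
      have hadd := add_mem_of_card_eq_three hS3 hS0 hx hy hxy
      obtain ⟨h1, h2, h3⟩ := hne (hSd hx) (hSd hy) (hSd hadd)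
      refine ⟨⟨⟨hSd hx, hSd hy⟩, hSd hadd⟩, eq_of_subset_of_card_le ?_ ?_⟩
      · intro z
        simp only [mem_insert, mem_singleton]
        rintro (rfl | rfl | rfl) <;> assumption
      · rw [hS3, card_eq_three.2 ⟨_, _, _, h1, h2, h3, rfl⟩]
  · rintro ⟨x, y⟩ hp
    simp only [coe_filter, mem_product, Set.mem_ofPred_eq, mem_powersetCard] at hp ⊢
    obtain ⟨⟨hx, hy⟩, hxy⟩ := hp
    obtain ⟨h1, h2, h3⟩ := hne hx hy hxy
    refine ⟨⟨?_, card_eq_three.2 ⟨_, _, _, h1, h2, h3, rfl⟩⟩, ?_⟩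
    · intro z
      simp only [mem_insert, mem_singleton]
      rintro (rfl | rfl | rfl) <;> assumption
    · rw [sum_insert (by simp only [mem_insert, mem_singleton]; tauto),
        sum_insert (by simpa using h3), sum_singleton]
      simp only [id]
      rw [← add_assoc, hchar]

lemma schurCount_insert_zero {d : Finset (V m)} (h0 : 0 ∉ d) :
    schurCount (insert 0 d) = 6 * wordCount m d 3 + 3 * #d + 1 := by
  rw [← card_pairs_eq_six_mul_wordCount h0, schurCount]
  simp only [card_filter, sum_product]
  rw [sum_insert h0]
  simp_rw [sum_insert h0]
  have h1 : ∀ x ∈ d, (∑ y ∈ d, if x + y ∈ insert 0 d then 1 else 0) =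
      1 + ∑ y ∈ d, if x + y ∈ d then 1 else 0 := by
    intro x hx
    have h2 : ∀ y ∈ d, (if x + y ∈ insert 0 d then 1 else 0) =
        (if x = y then 1 else 0) + if x + y ∈ d then 1 else 0 := by
      intro y _
      by_cases hxy : x = y
      · subst hxy
        simp [add_self_eq_zero_of_zmod_two, h0]
      · simp [hxy, add_eq_zero_iff_eq_of_zmod_two]
    rw [sum_congr rfl h2, sum_add_distrib, sum_ite_eq, if_pos hx]
  have h2 : ∀ x ∈ d, (if x ∈ insert 0 d then 1 else 0) = 1 := fun x hx => by simp [hx]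
  simp only [zero_add, add_zero, sum_add_distrib, sum_congr rfl h1, sum_congr rfl h2]
  simp
  ring

lemma card_span_eq_two_pow_rankOf (d : Finset (V m))
    [Fintype (Submodule.span (ZMod 2) (d : Set (V m)))] :
    Fintype.card (Submodule.span (ZMod 2) (d : Set (V m))) = 2 ^ rankOf m d := by
  rw [Module.card_eq_pow_finrank (K := ZMod 2), ZMod.card, rankOf]

lemma card_succ_le_two_pow_rankOf {d : Finset (V m)} (hd : d ⊆ Hm m) :
    #d + 1 ≤ 2 ^ rankOf m d := by
  classical
  rw [← card_insert_of_notMem (zero_notMem_of_subset_Hm hd), ← card_span_eq_two_pow_rankOf,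
    ← Finset.card_univ, ← Finset.card_map (Function.Embedding.subtype _)]
  refine card_le_card fun x hx => ?_
  simp only [mem_map, mem_univ, true_and, Function.Embedding.subtype_apply, Subtype.exists,
    exists_prop, exists_eq_right]
  rcases mem_insert.1 hx with rfl | hx
  · exact zero_mem _
  · exact Submodule.subset_span hx

/-- A design of rank exceeding the minimum has fewer zero-sum triples than some design of the same
size. -/
lemma exists_wordCount_lt_of_clog_lt_rankOf {d : Finset (V m)} (hd : d ⊆ Hm m) (hpos : 1 ≤ #d)
    (hr : Nat.clog 2 (#d + 1) < rankOf m d) :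
    ∃ d' ⊆ Hm m, #d' = #d ∧ wordCount m d 3 < wordCount m d' 3 := by
  classical
  have h0 := zero_notMem_of_subset_Hm hd
  obtain ⟨s, hs⟩ : ∃ s, Nat.clog 2 (#d + 1) = s + 1 :=
    Nat.exists_eq_succ_of_ne_zero (Nat.clog_pos (by norm_num) (by omega)).ne'
  have hs2 : #d + 1 ≤ 2 ^ (s + 1) := hs ▸ Nat.le_pow_clog (by norm_num) _
  have hs1 : 2 ^ s < #d + 1 := (Nat.lt_clog_iff_pow_lt (by norm_num)).1 (by omega)
  let W := Submodule.span (ZMod 2) (d : Set (V m))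
  have hWcard : Fintype.card W = 2 ^ rankOf m d := card_span_eq_two_pow_rankOf d
  have hdW : ∀ x ∈ insert 0 d, x ∈ W := fun x hx => by
    rcases mem_insert.1 hx with rfl | hx
    · exact zero_mem _
    · exact Submodule.subset_span hx
  let A : Finset W := Finset.subtype (· ∈ W) (insert 0 d)
  have hAmap : A.map (Function.Embedding.subtype (· ∈ W)) = insert 0 d :=
    Finset.subtype_map_of_mem hdW
  have hAcard : #A = #d + 1 := by
    rw [← card_insert_of_notMem h0, ← hAmap, card_map]
  have hAspan : Submodule.span (ZMod 2) (A : Set W) = ⊤ := by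
    rw [← top_le_iff, ← Submodule.span_span_coe_preimage (R := ZMod 2) (s := (d : Set (V m)))]
    refine Submodule.span_mono fun x hx => ?_
    simpa [A] using Or.inr hx
  have hAlt := schurCount_lt_of_span_eq_top (rankOf m d) hWcard (A := A) (s := s)
    (by simp [A]) hAspan
    (by
      have := Nat.pow_le_pow_right (n := 2) (by norm_num) (show s + 1 + 1 ≤ rankOf m d by omega)
      rw [pow_succ] at this
      omega)
    (by omega) (by omega)
  rw [← schurCount_map (Function.Embedding.subtype (· ∈ W)) (fun _ _ => rfl), hAmap,
    hAcard, schurCount_insert_zero h0] at hAlt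
  obtain ⟨U, hU⟩ := exists_submodule_finrank_eq (K := ZMod 2) (W := V m) (n := s + 1)
    ((show s + 1 ≤ rankOf m d by omega).trans (Submodule.finrank_le _))
  have hUcard : Fintype.card U = 2 ^ (s + 1) := by
    rw [Module.card_eq_pow_finrank (K := ZMod 2), ZMod.card, hU]
  obtain ⟨B, hB0, hBcard, hB⟩ := exists_schurCount_eq hUcard hs1.le hs2
  rw [← schurCount_map (Function.Embedding.subtype (· ∈ U)) (fun _ _ => rfl)] at hB
  have hB0' : 0 ∈ B.map (Function.Embedding.subtype (· ∈ U)) := mem_map.2 ⟨0, hB0, rfl⟩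
  have hcard' : #((B.map (Function.Embedding.subtype (· ∈ U))).erase 0) = #d := by
    rw [card_erase_of_mem hB0', card_map, hBcard, Nat.add_sub_cancel]
  refine ⟨(B.map (Function.Embedding.subtype (· ∈ U))).erase 0, ?_, hcard', ?_⟩
  · intro x hx
    simpa [Hm] using (mem_erase.1 hx).1
  · have hT := schurCount_insert_zero (notMem_erase 0 (B.map (Function.Embedding.subtype (· ∈ U))))
    rw [insert_erase hB0', hcard'] at hT
    rw [hT] at hB
    rw [← hB] at hAlt
    norm_cast at hAlt
    omega

end WordCount

/-- If `d̄ ⊆ H_m` has `h ≥ 1` elements and rank greater than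
`⌈log₂(h+1)⌉`, then some `h`-element subset `d̄' ⊆ H_m` has strictly more zero-sum
triples; consequently any `h`-element subset of `H_m` maximizing `a₃` has minimum rank. -/
theorem a3_maximizer_has_minimum_rank (m : ℕ) (hm : 2 ≤ m)
    (dbar : Finset (V m)) (hsub : dbar ⊆ Hm m) (h : ℕ) (hcard : dbar.card = h)
    (hh : 1 ≤ h) :
    (Nat.clog 2 (h + 1) < rankOf m dbar →
      ∃ dbar' ⊆ Hm m, dbar'.card = h ∧ wordCount m dbar 3 < wordCount m dbar' 3) ∧
    ((∀ f ⊆ Hm m, f.card = h → wordCount m f 3 ≤ wordCount m dbar 3) →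
      ∀ f ⊆ Hm m, f.card = h → rankOf m dbar ≤ rankOf m f) := by
  subst hcard
  have hfirst := exists_wordCount_lt_of_clog_lt_rankOf hsub hh
  refine ⟨hfirst, fun hmax f hf hfcard => ?_⟩
  have hrank : rankOf m dbar ≤ Nat.clog 2 (#dbar + 1) := by
    by_contra! hlt
    obtain ⟨d', hd', hcard', hlt'⟩ := hfirst hlt
    exact (hmax d' hd' hcard').not_gt hlt'
  refine hrank.trans (Nat.clog_le_of_le_pow ?_)
  rw [← hfcard]
  exact card_succ_le_two_pow_rankOf hf
end

section
/- Let l = 2^{m−1}. The word-length pattern of the saturated resolution-IV design O_m satisfies: a_i(O_m) = 0 for every odd i, a_2(O_m) = 0, and for every r ≥ 1, as an identity of integers, (2r + 2)·a_{2r+2}(O_m) = C(l, 2r+1) − (l − 2r)·a_{2r}(O_m). -/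
open Finset Polynomial

theorem mem_Om {m : ℕ} {v : V m} : v ∈ Om m ↔ ∑ i, v i = 1 := by simp [Om]

theorem add_self_V {m : ℕ} (v : V m) : v + v = 0 := by
  ext i; exact CharTwo.add_self_eq_zero _

theorem eq_of_add_eq_zero_V {m : ℕ} {v w : V m} (h : v + w = 0) : v = w := by
  have h' : v + w = w + w := h.trans (add_self_V w).symm
  exact add_right_cancel h'

/-- The coordinate sum of a sum of odd-weight vectors is the parity of the number of summands. -/
theorem coord_sum_of_subset_Om {m : ℕ} {S : Finset (V m)} (hS : S ⊆ Om m) :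
    ∑ i, (S.sum id) i = (S.card : ZMod 2) := by
  simp only [Finset.sum_apply, id]
  rw [Finset.sum_comm, Finset.sum_congr rfl (fun v hv => mem_Om.1 (hS hv))]
  simp

theorem sum_mem_Om_of_odd_card {m : ℕ} {S : Finset (V m)} (hS : S ⊆ Om m) (h : Odd S.card) :
    S.sum id ∈ Om m := by
  rw [mem_Om, coord_sum_of_subset_Om hS]
  exact ZMod.natCast_eq_one_iff_odd.2 h

theorem wordCount_Om_of_odd (m i : ℕ) (hi : Odd i) : wordCount m (Om m) i = 0 := by
  rw [wordCount, sumCount, Finset.card_eq_zero, Finset.filter_eq_empty_iff]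
  intro S hS h0
  obtain ⟨hSd, rfl⟩ := Finset.mem_powersetCard.1 hS
  have h := mem_Om.1 (sum_mem_Om_of_odd_card hSd hi)
  rw [h0] at h
  simp at h

theorem wordCount_two (m : ℕ) (d : Finset (V m)) : wordCount m d 2 = 0 := by
  rw [wordCount, sumCount, Finset.card_eq_zero, Finset.filter_eq_empty_iff]
  intro S hS h0
  obtain ⟨x, y, hxy, rfl⟩ := Finset.card_eq_two.1 (Finset.mem_powersetCard.1 hS).2
  rw [Finset.sum_pair hxy] at h0
  exact hxy (eq_of_add_eq_zero_V h0)

theorem card_Om (m : ℕ) (hm : 1 ≤ m) : (Om m).card = 2 ^ (m - 1) := by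
  obtain ⟨n, rfl⟩ : ∃ n, m = n + 1 := ⟨m - 1, by omega⟩
  have h : (Om (n + 1)).card = (Finset.univ : Finset (Fin n → ZMod 2)).card := by
    refine Finset.card_nbij' (fun v => Fin.tail v) (fun w => Fin.cons (1 - ∑ i, w i) w)
      (fun _ _ => Finset.mem_coe.2 (Finset.mem_univ _)) ?_ ?_ ?_
    · intro w _
      simp [mem_Om, Fin.sum_univ_succ]
    · intro v hv
      rw [Finset.mem_coe, mem_Om, Fin.sum_univ_succ] at hv
      have : 1 - ∑ i, Fin.tail v i = v 0 := by rw [← hv]; simp [Fin.tail]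
      simp only [this, Fin.cons_self_tail]
    · intro w _
      simp
  rw [h]
  simp [ZMod.card]

/-- The `n`-subsets of `d` whose sum is an element of `d` outside the subset correspond to
`(n + 1)`-words of `d` with a marked element. -/
theorem card_sum_mem_sdiff (m : ℕ) (d : Finset (V m)) (n : ℕ) :
    ((d.powersetCard n).filter (fun S => S.sum id ∈ d ∧ S.sum id ∉ S)).card =
      (n + 1) * wordCount m d (n + 1) := by
  have h : (n + 1) * wordCount m d (n + 1) =
      (((d.powersetCard (n + 1)).filter (fun S => S.sum id = 0)).sigma (fun W => W)).card := by
    rw [Finset.card_sigma, Finset.sum_congr rfl (g := fun _ => n + 1), Finset.sum_const,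
      smul_eq_mul, mul_comm]
    · rfl
    · intro W hW
      exact (Finset.mem_powersetCard.1 (Finset.mem_filter.1 hW).1).2
  rw [h]
  refine Finset.card_nbij' (fun S => ⟨insert (S.sum id) S, S.sum id⟩) (fun p => p.1.erase p.2)
    ?_ ?_ ?_ ?_
  · intro S hS
    simp only [Finset.coe_filter, Finset.mem_powersetCard, Set.mem_ofPred_eq] at hS
    obtain ⟨⟨hSd, hc⟩, hd, hn⟩ := hS
    simp only [Finset.mem_coe, Finset.mem_sigma, Finset.mem_filter, Finset.mem_powersetCard]
    refine ⟨⟨⟨Finset.insert_subset hd hSd, by rw [Finset.card_insert_of_notMem hn, hc]⟩, ?_⟩,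
      Finset.mem_insert_self _ _⟩
    rw [Finset.sum_insert hn]
    exact add_self_V _
  · rintro ⟨W, s⟩ hW
    simp only [Finset.mem_coe, Finset.mem_sigma, Finset.mem_filter,
      Finset.mem_powersetCard] at hW
    obtain ⟨⟨⟨hWd, hc⟩, h0⟩, hs⟩ := hW
    have hsum : (W.erase s).sum id = s :=
      (eq_of_add_eq_zero_V ((Finset.add_sum_erase W id hs).trans h0)).symm
    simp only [Finset.coe_filter, Finset.mem_powersetCard, Set.mem_ofPred_eq, hsum]
    exact ⟨⟨(Finset.erase_subset _ _).trans hWd, by rw [Finset.card_erase_of_mem hs, hc]; rfl⟩,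
      hWd hs, Finset.notMem_erase _ _⟩
  · intro S hS
    exact Finset.erase_insert (Finset.mem_filter.1 hS).2.2
  · rintro ⟨W, s⟩ hW
    simp only [Finset.mem_coe, Finset.mem_sigma, Finset.mem_filter] at hW
    obtain ⟨⟨_, h0⟩, hs⟩ := hW
    have hsum : (W.erase s).sum id = s :=
      (eq_of_add_eq_zero_V ((Finset.add_sum_erase W id hs).trans h0)).symm
    simp only [hsum, Finset.insert_erase hs]

/-- The `(n + 1)`-subsets of `d` whose sum lies in the subset correspond to `n`-words of `d`
together with an element of `d` outside the word. -/
theorem card_sum_mem_self (m : ℕ) (d : Finset (V m)) (n : ℕ) :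
    ((d.powersetCard (n + 1)).filter (fun S => S.sum id ∈ S)).card =
      (d.card - n) * wordCount m d n := by
  have h : (d.card - n) * wordCount m d n =
      (((d.powersetCard n).filter (fun S => S.sum id = 0)).sigma (fun W => d \ W)).card := by
    rw [Finset.card_sigma, Finset.sum_congr rfl (g := fun _ => d.card - n), Finset.sum_const,
      smul_eq_mul, mul_comm]
    · rfl
    · intro W hW
      obtain ⟨hWd, hc⟩ := Finset.mem_powersetCard.1 (Finset.mem_filter.1 hW).1
      rw [Finset.card_sdiff_of_subset hWd, hc]
  rw [h]
  refine Finset.card_nbij' (fun S => ⟨S.erase (S.sum id), S.sum id⟩) (fun p => insert p.2 p.1)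
    ?_ ?_ ?_ ?_
  · intro S hS
    simp only [Finset.coe_filter, Finset.mem_powersetCard, Set.mem_ofPred_eq] at hS
    obtain ⟨⟨hSd, hc⟩, hs⟩ := hS
    simp only [Finset.mem_coe, Finset.mem_sigma, Finset.mem_filter, Finset.mem_powersetCard,
      Finset.mem_sdiff]
    refine ⟨⟨⟨(Finset.erase_subset _ _).trans hSd,
      by rw [Finset.card_erase_of_mem hs, hc]; rfl⟩, ?_⟩, hSd hs, Finset.notMem_erase _ _⟩
    have := Finset.add_sum_erase S id hs
    simpa using this
  · rintro ⟨W, s⟩ hW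
    simp only [Finset.mem_coe, Finset.mem_sigma, Finset.mem_filter,
      Finset.mem_powersetCard, Finset.mem_sdiff] at hW
    obtain ⟨⟨⟨hWd, hc⟩, h0⟩, hsd, hs⟩ := hW
    have hsum : (insert s W).sum id = s := by rw [Finset.sum_insert hs, h0]; simp
    simp only [Finset.coe_filter, Finset.mem_powersetCard, Set.mem_ofPred_eq, hsum]
    exact ⟨⟨Finset.insert_subset hsd hWd, by rw [Finset.card_insert_of_notMem hs, hc]⟩,
      Finset.mem_insert_self _ _⟩
  · intro S hS
    exact Finset.insert_erase (Finset.mem_filter.1 hS).2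
  · rintro ⟨W, s⟩ hW
    simp only [Finset.mem_coe, Finset.mem_sigma, Finset.mem_filter, Finset.mem_sdiff] at hW
    obtain ⟨⟨_, h0⟩, _, hs⟩ := hW
    have hsum : (insert s W).sum id = s := by rw [Finset.sum_insert hs, h0]; simp
    simp only [hsum, Finset.erase_insert hs]

theorem wordCount_eq_zero_of_card_lt (m : ℕ) (d : Finset (V m)) (n : ℕ) (h : d.card < n) :
    wordCount m d n = 0 := by
  simp [wordCount, sumCount, Finset.powersetCard_eq_empty.2 h]

/-- Every odd-size subset of `O_m` has its sum in `O_m`, either inside or outside the subset. -/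
theorem choose_card_Om (m n : ℕ) (hn : Even n) :
    (Om m).card.choose (n + 1) =
      ((Om m).card - n) * wordCount m (Om m) n + (n + 2) * wordCount m (Om m) (n + 2) := by
  rw [← Finset.card_powersetCard, ← card_sum_mem_self, ← card_sum_mem_sdiff m (Om m) (n + 1),
    ← Finset.card_filter_add_card_filter_not (s := (Om m).powersetCard (n + 1))
      (fun S => S.sum id ∈ S)]
  congr 2
  refine Finset.filter_congr fun S hS => ?_
  obtain ⟨hS, hc⟩ := Finset.mem_powersetCard.1 hS
  have := sum_mem_Om_of_odd_card hS (hc ▸ hn.add_one)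
  tauto

/-- With `l = 2^{m-1}`, the word-length pattern of the saturated
resolution-IV design `O_m` satisfies `a_i = 0` for odd `i`, `a₂ = 0`, and the
recurrence `(2r+2)·a_{2r+2} = C(l, 2r+1) - (l - 2r)·a_{2r}` for `r ≥ 1`. -/
theorem WLP_of_Om_recurrence (m : ℕ) (hm : 2 ≤ m) :
    (∀ i, Odd i → wordCount m (Om m) i = 0) ∧
    wordCount m (Om m) 2 = 0 ∧
    (∀ r : ℕ, 1 ≤ r →
      (2 * (r : ℤ) + 2) * wordCount m (Om m) (2 * r + 2) =
        (Nat.choose (2 ^ (m - 1)) (2 * r + 1) : ℤ) -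
          ((2 ^ (m - 1) : ℤ) - 2 * r) * wordCount m (Om m) (2 * r)) := by
  refine ⟨wordCount_Om_of_odd m, wordCount_two m _, fun r _ => ?_⟩
  have h := choose_card_Om m (2 * r) (even_two_mul r)
  have hw : (((Om m).card - 2 * r : ℕ) : ℤ) * wordCount m (Om m) (2 * r) =
      (((Om m).card : ℤ) - 2 * r) * wordCount m (Om m) (2 * r) := by
    rcases lt_or_ge (Om m).card (2 * r) with hlt | hle
    · simp [wordCount_eq_zero_of_card_lt m _ _ hlt]
    · push_cast [Nat.cast_sub hle]; ring
  have hc := card_Om m (by omega)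
  zify at h
  rw [hw] at h
  rw [hc] at h
  push_cast at h
  linarith
end
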